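/- Let p ≥ 2, α = p−1 and θ ≥ 0. For every σ with 0 < σ ≤ μ_{α,θ} the critical and subcritical suprema are related by the identity TMC(σ,α,θ) = sup_{μ ∈ (0,σ)} [(1 − (μ/σ)^{p−1}) / (μ/σ)^{p−1}] · TMSC(μ,α,θ). -/

import Mathlib

open MeasureTheory Real Filter ENNReal

/-- The fractional-dimension spherical volume constant `ω_θ = 2π^((θ+1)/2)/Γ((θ+1)/2)`. -/
noncomputable def omegaW (θ : ℝ) : ℝ := 2 * Real.pi ^ ((θ + 1) / 2) / Real.Gamma ((θ + 1) / 2)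

/-- Weighted integral `∫₀^∞ f dλ_θ = ω_θ ∫₀^∞ f(r) r^θ dr` (for nonnegative integrands,
valued in `ℝ≥0∞`). -/
noncomputable def wInt (θ : ℝ) (f : ℝ → ℝ) : ℝ≥0∞ :=
  ENNReal.ofReal (omegaW θ) *
    ∫⁻ r in Set.Ioi (0 : ℝ), ENNReal.ofReal (f r) * ENNReal.ofReal (r ^ θ)

/-- The weighted Lebesgue norm `‖u‖_{L^q_θ}` (valued in `ℝ≥0∞`). -/
noncomputable def wNorm (θ q : ℝ) (u : ℝ → ℝ) : ℝ≥0∞ :=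
  (wInt θ fun r => |u r| ^ q) ^ (1 / q)

/-- Membership in the weighted Sobolev space `X = X^{1,p}_∞(α,θ)`:
`u` is locally absolutely continuous on `(0,∞)` with a.e. derivative `u'`
(expressed through the fundamental theorem of calculus on compact subintervals),
`u(r) → 0` as `r → ∞`, `‖u‖_{L^p_θ} < ∞` and `‖u'‖_{L^p_α} < ∞`. -/
structure MemX (p α θ : ℝ) (u u' : ℝ → ℝ) : Prop where
  ftc_int : ∀ a b : ℝ, 0 < a → a ≤ b → IntervalIntegrable u' MeasureTheory.volume a b
  ftc : ∀ a b : ℝ, 0 < a → a ≤ b → u b - u a = ∫ t in a..b, u' t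
  lim_zero : Filter.Tendsto u Filter.atTop (nhds 0)
  fin_u : wNorm θ p u < ⊤
  fin_u' : wNorm α p u' < ⊤

/-- Full norm on `X`: `‖u‖ = (‖u‖_{L^p_θ}^p + ‖u'‖_{L^p_α}^p)^{1/p}`. -/
noncomputable def Xnorm (p α θ : ℝ) (u u' : ℝ → ℝ) : ℝ≥0∞ :=
  ((wNorm θ p u) ^ p + (wNorm α p u') ^ p) ^ (1 / p)

/-- The truncated exponential `φ_p(t) = Σ_{j ∈ ℕ, j ≥ p-1} t^j / j!`. -/
noncomputable def phiP (p t : ℝ) : ℝ :=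
  ∑' j : ℕ, if p - 1 ≤ (j : ℝ) then t ^ j / (Nat.factorial j : ℝ) else 0

/-- The critical constant `μ_{α,θ} = (θ+1) ω_α^{1/α}`. -/
noncomputable def muC (α θ : ℝ) : ℝ := (θ + 1) * (omegaW α) ^ (1 / α)

/-- The Trudinger–Moser functional `∫₀^∞ φ_p(μ |u|^{p/(p-1)}) dλ_θ`. -/
noncomputable def TMfunc (p θ μ : ℝ) (u : ℝ → ℝ) : ℝ≥0∞ :=
  wInt θ fun r => phiP p (μ * |u r| ^ (p / (p - 1)))

/-- The subcritical Trudinger–Moser supremum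
`TMSC(μ,α,θ) = sup { ‖u‖_{L^p_θ}^{-p} ∫₀^∞ φ_p(μ|u|^{p/(p-1)}) dλ_θ : u ∈ X, u ≠ 0, ‖u'‖_{L^p_α} ≤ 1 }`. -/
noncomputable def TMSC (p α θ μ : ℝ) : ℝ≥0∞ :=
  ⨆ (u : ℝ → ℝ) (u' : ℝ → ℝ) (_ : MemX p α θ u u') (_ : u ≠ 0)
    (_ : wNorm α p u' ≤ 1), (wNorm θ p u) ^ (-p) * TMfunc p θ μ u

/-- The critical Trudinger–Moser supremum
`TMC(σ,α,θ) = sup { ∫₀^∞ φ_p(σ|u|^{p/(p-1)}) dλ_θ : u ∈ X, ‖u‖ ≤ 1 }`. -/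
noncomputable def TMC (p α θ σ : ℝ) : ℝ≥0∞ :=
  ⨆ (u : ℝ → ℝ) (u' : ℝ → ℝ) (_ : MemX p α θ u u') (_ : Xnorm p α θ u u' ≤ 1),
    TMfunc p θ σ u

/-- `k₀ = min { j ∈ ℕ : j ≥ p - 1 }`. -/
noncomputable def k0 (p : ℝ) : ℕ := sInf {j : ℕ | p - 1 ≤ (j : ℝ)}

/-- `TMC(σ,α,θ)` is attained by some `u ∈ X` with `‖u‖ ≤ 1`. -/
def TMCAttained (p α θ σ : ℝ) : Prop :=
  ∃ u u' : ℝ → ℝ, MemX p α θ u u' ∧ Xnorm p α θ u u' ≤ 1 ∧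
    TMC p α θ σ = TMfunc p θ σ u

/-- `σ_* = inf { σ ∈ (0, μ_{α,θ}) : TMC(σ,α,θ) is attained }`. -/
noncomputable def sigmaStar (p α θ : ℝ) : ℝ :=
  sInf {σ : ℝ | σ ∈ Set.Ioo 0 (muC α θ) ∧ TMCAttained p α θ σ}

lemma omegaW_pos {θ : ℝ} (hθ : 0 ≤ θ) : 0 < omegaW θ := by
  unfold omegaW
  have := Real.Gamma_pos_of_pos (show 0 < (θ + 1) / 2 by linarith)
  positivity

lemma wNorm_rpow {p : ℝ} (hp : 0 < p) (θ : ℝ) (u : ℝ → ℝ) :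
    wNorm θ p u ^ p = wInt θ fun r => |u r| ^ p := by
  unfold wNorm
  rw [← ENNReal.rpow_mul, one_div_mul_cancel hp.ne', ENNReal.rpow_one]

lemma wNorm_lt_top_iff {p : ℝ} (hp : 0 < p) (θ : ℝ) (u : ℝ → ℝ) :
    wNorm θ p u < ⊤ ↔ (wInt θ fun r => |u r| ^ p) < ⊤ := by
  rw [← wNorm_rpow hp, ENNReal.rpow_lt_top_iff_of_pos hp]

lemma ennreal_rpow_le_one_iff {p : ℝ} (hp : 0 < p) (x : ℝ≥0∞) : x ^ p ≤ 1 ↔ x ≤ 1 := by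
  simpa using ENNReal.rpow_le_rpow_iff (x := x) (y := 1) hp

lemma wNorm_le_one_iff {p : ℝ} (hp : 0 < p) (θ : ℝ) (u : ℝ → ℝ) :
    wNorm θ p u ≤ 1 ↔ (wInt θ fun r => |u r| ^ p) ≤ 1 := by
  rw [← wNorm_rpow hp, ennreal_rpow_le_one_iff hp]

lemma Xnorm_le_one_iff {p : ℝ} (hp : 0 < p) (α θ : ℝ) (u u' : ℝ → ℝ) :
    Xnorm p α θ u u' ≤ 1 ↔
      (wInt θ fun r => |u r| ^ p) + (wInt α fun r => |u' r| ^ p) ≤ 1 := by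
  unfold Xnorm
  rw [ennreal_rpow_le_one_iff (by positivity), wNorm_rpow hp, wNorm_rpow hp]

lemma lintegral_comp_mul_left {l : ℝ} (hl : 0 < l) (g : ℝ → ℝ≥0∞) :
    ∫⁻ r, g (l * r) = ENNReal.ofReal l⁻¹ * ∫⁻ r, g r := by
  have h := Real.map_volume_mul_left hl.ne'
  rw [abs_of_pos (inv_pos.2 hl)] at h
  rw [← smul_eq_mul, ← lintegral_smul_measure, ← h]
  exact ((Homeomorph.mulLeft₀ l hl.ne').measurableEmbedding.lintegral_map g).symm

lemma wInt_comp_mul_left {l : ℝ} (hl : 0 < l) (θ : ℝ) (f : ℝ → ℝ) :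
    wInt θ (fun r => f (l * r)) = ENNReal.ofReal (l ^ (-(θ + 1))) * wInt θ f := by
  unfold wInt
  have key : ∫⁻ r in Set.Ioi (0 : ℝ), ENNReal.ofReal (f (l * r)) * ENNReal.ofReal (r ^ θ) =
      ENNReal.ofReal (l ^ (-(θ + 1))) *
        ∫⁻ r in Set.Ioi (0 : ℝ), ENNReal.ofReal (f r) * ENNReal.ofReal (r ^ θ) := by
    rw [← lintegral_indicator measurableSet_Ioi, ← lintegral_indicator measurableSet_Ioi]
    have h := lintegral_comp_mul_left hl (Set.indicator (Set.Ioi (0 : ℝ))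
      fun r => ENNReal.ofReal (f r) * ENNReal.ofReal (r ^ θ))
    have e : ENNReal.ofReal (l ^ (-(θ + 1))) =
        ENNReal.ofReal (l ^ (-θ)) * ENNReal.ofReal l⁻¹ := by
      rw [← ENNReal.ofReal_mul (by positivity), neg_add, Real.rpow_add hl, Real.rpow_neg_one]
    rw [e, mul_assoc, ← h, ← lintegral_const_mul' _ _ ENNReal.ofReal_ne_top]
    refine lintegral_congr fun r => ?_
    by_cases hr : 0 < r
    · have hlr : 0 < l * r := mul_pos hl hr
      rw [Set.indicator_of_mem (Set.mem_Ioi.2 hr), Set.indicator_of_mem (Set.mem_Ioi.2 hlr),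
        mul_left_comm, ← ENNReal.ofReal_mul (Real.rpow_nonneg hl.le _),
        Real.mul_rpow hl.le hr.le, ← mul_assoc, ← Real.rpow_add hl, neg_add_cancel,
        Real.rpow_zero, one_mul]
    · have hlr : ¬ 0 < l * r := by
        rw [mul_pos_iff_of_pos_left hl]
        exact hr
      rw [Set.indicator_of_notMem (by simpa using hr),
        Set.indicator_of_notMem (by simpa using hlr), mul_zero]
  rw [key, mul_left_comm]

lemma wInt_const_mul {k : ℝ} (hk : 0 ≤ k) (θ : ℝ) (f : ℝ → ℝ) :
    wInt θ (fun r => k * f r) = ENNReal.ofReal k * wInt θ f := by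
  unfold wInt
  simp_rw [ENNReal.ofReal_mul hk, mul_assoc]
  rw [lintegral_const_mul' _ _ ENNReal.ofReal_ne_top, mul_left_comm]

lemma wInt_dilation {c l : ℝ} (hc : 0 < c) (hl : 0 < l) (p θ : ℝ) (u : ℝ → ℝ) :
    (wInt θ fun r => |c * u (l * r)| ^ p) =
      ENNReal.ofReal (c ^ p * l ^ (-(θ + 1))) * wInt θ fun r => |u r| ^ p := by
  rw [ENNReal.ofReal_mul (by positivity), mul_assoc, ← wInt_comp_mul_left hl,
    ← wInt_const_mul (by positivity)]
  congr 1
  ext r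
  rw [abs_mul, abs_of_pos hc, Real.mul_rpow hc.le (abs_nonneg _)]

lemma TMfunc_dilation {c l : ℝ} (hc : 0 < c) (hl : 0 < l) (p θ μ : ℝ) (u : ℝ → ℝ) :
    TMfunc p θ μ (fun r => c * u (l * r)) =
      ENNReal.ofReal (l ^ (-(θ + 1))) * TMfunc p θ (μ * c ^ (p / (p - 1))) u := by
  unfold TMfunc
  rw [← wInt_comp_mul_left hl]
  congr 1
  ext r
  rw [abs_mul, abs_of_pos hc, Real.mul_rpow hc.le (abs_nonneg _), mul_assoc]

lemma wInt_deriv_dilation {p c l : ℝ} (hc : 0 < c) (hl : 0 < l) (u' : ℝ → ℝ) :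
    (wInt (p - 1) fun r => |c * l * u' (l * r)| ^ p) =
      ENNReal.ofReal (c ^ p) * wInt (p - 1) fun r => |u' r| ^ p := by
  rw [wInt_dilation (mul_pos hc hl) hl, Real.mul_rpow hc.le hl.le, mul_assoc,
    ← Real.rpow_add hl]
  simp

lemma MemX.dilation {p θ : ℝ} (hp : 0 < p) {u u' : ℝ → ℝ} (h : MemX p (p - 1) θ u u')
    {c l : ℝ} (hc : 0 < c) (hl : 0 < l) :
    MemX p (p - 1) θ (fun r => c * u (l * r)) (fun r => c * l * u' (l * r)) where
  ftc_int a b ha hab := by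
    have h1 := h.ftc_int (l * a) (l * b) (by positivity) (by gcongr)
    have h2 := h1.comp_mul_left (c := l)
    rw [mul_div_cancel_left₀ _ hl.ne', mul_div_cancel_left₀ _ hl.ne'] at h2
    exact h2.const_mul _
  ftc a b ha hab := by
    have h1 := h.ftc (l * a) (l * b) (by positivity) (by gcongr)
    rw [intervalIntegral.integral_const_mul, mul_assoc,
      intervalIntegral.mul_integral_comp_mul_left, ← h1]
    ring
  lim_zero := by
    have := (h.lim_zero.comp (tendsto_id.const_mul_atTop hl)).const_mul c
    simpa using this
  fin_u := by
    rw [wNorm_lt_top_iff hp, wInt_dilation hc hl]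
    exact ENNReal.mul_lt_top ENNReal.ofReal_lt_top ((wNorm_lt_top_iff hp _ _).1 h.fin_u)
  fin_u' := by
    rw [wNorm_lt_top_iff hp, wInt_deriv_dilation hc hl]
    exact ENNReal.mul_lt_top ENNReal.ofReal_lt_top ((wNorm_lt_top_iff hp _ _).1 h.fin_u')

lemma phiP_zero {p : ℝ} (hp : 1 < p) : phiP p 0 = 0 := by
  unfold phiP
  refine (tsum_congr fun j => ?_).trans tsum_zero
  split_ifs with hj
  · have : j ≠ 0 := by
      rintro rfl
      norm_num at hj
      linarith
    simp [this]
  · rfl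

lemma TMfunc_eq_zero {p θ μ : ℝ} (hp : 1 < p) {u : ℝ → ℝ}
    (hu : ∀ᵐ r ∂volume.restrict (Set.Ioi (0 : ℝ)), u r = 0) : TMfunc p θ μ u = 0 := by
  unfold TMfunc wInt
  have hq : p / (p - 1) ≠ 0 := (div_pos (by linarith) (by linarith)).ne'
  rw [lintegral_congr_ae (g := fun _ => 0), lintegral_zero, mul_zero]
  filter_upwards [hu] with r hr
  simp [hr, Real.zero_rpow hq, phiP_zero hp]

lemma ae_eq_zero_of_wInt_eq_zero {p θ : ℝ} (hθ : 0 ≤ θ) {f : ℝ → ℝ}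
    (hf : AEMeasurable f (volume.restrict (Set.Ioi (0 : ℝ))))
    (h : (wInt θ fun r => |f r| ^ p) = 0) :
    ∀ᵐ r ∂volume.restrict (Set.Ioi (0 : ℝ)), f r = 0 := by
  unfold wInt at h
  have hω : ENNReal.ofReal (omegaW θ) ≠ 0 := by simpa using omegaW_pos hθ
  have h0 := (mul_eq_zero.1 h).resolve_left hω
  rw [lintegral_eq_zero_iff' (by fun_prop)] at h0
  filter_upwards [h0, ae_restrict_mem measurableSet_Ioi] with r hr hr0
  have h1 : ENNReal.ofReal (r ^ θ) ≠ 0 := by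
    simpa using Real.rpow_pos_of_pos hr0 θ
  have h2 := (mul_eq_zero.1 hr).resolve_right h1
  by_contra hne
  have : 0 < |f r| ^ p := by positivity
  exact absurd (ENNReal.ofReal_eq_zero.1 h2) (not_le.2 this)

lemma MemX.aemeasurable_deriv {p α θ : ℝ} {u u' : ℝ → ℝ} (h : MemX p α θ u u') :
    AEMeasurable u' (volume.restrict (Set.Ioi (0 : ℝ))) := by
  have hU : Set.Ioi (0 : ℝ) ⊆ ⋃ n : ℕ, Set.Ioc ((n + 1 : ℝ)⁻¹) (n + 1) := by
    intro r hr
    obtain ⟨n, hn⟩ := exists_nat_gt (max r r⁻¹)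
    have hr0 : 0 < r := hr
    have h1 : r < n := (le_max_left _ _).trans_lt hn
    have h2 : r⁻¹ < n := (le_max_right _ _).trans_lt hn
    refine Set.mem_iUnion.2 ⟨n, inv_lt_of_inv_lt₀ hr0 (by linarith), by linarith⟩
  refine AEMeasurable.mono_measure ?_ (Measure.restrict_mono hU le_rfl)
  refine aemeasurable_iUnion_iff.2 fun n => ?_
  have hn : (1 : ℝ) ≤ n + 1 := by simp
  have := h.ftc_int ((n + 1 : ℝ)⁻¹) (n + 1) (by positivity) ((inv_le_one_of_one_le₀ hn).trans hn)
  exact this.1.aestronglyMeasurable.aemeasurable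

lemma MemX.continuousOn {p α θ : ℝ} {u u' : ℝ → ℝ} (h : MemX p α θ u u') :
    ContinuousOn u (Set.Ioi 0) := by
  intro r hr
  have hr0 : 0 < r := hr
  have hc : ContinuousOn (fun x => u (r / 2) + ∫ t in (r / 2)..x, u' t) (Set.Icc (r / 2) (2 * r)) := by
    have := intervalIntegral.continuousOn_primitive_interval'
      (h.ftc_int (r / 2) (2 * r) (by linarith) (by linarith)) (a := r / 2) Set.left_mem_uIcc
    rw [Set.uIcc_of_le (by linarith)] at this
    exact this.const_add _
  have hn : Set.Icc (r / 2) (2 * r) ∈ nhds r := Icc_mem_nhds (by linarith) (by linarith)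
  refine ((hc.continuousAt hn).congr ?_).continuousWithinAt
  filter_upwards [hn] with x hx
  rw [← h.ftc (r / 2) x (by linarith) hx.1]
  ring

lemma MemX.eq_zero_of_deriv {p α θ : ℝ} {u u' : ℝ → ℝ} (h : MemX p α θ u u')
    (h0 : ∀ᵐ r ∂volume.restrict (Set.Ioi (0 : ℝ)), u' r = 0) {r : ℝ} (hr : 0 < r) :
    u r = 0 := by
  have hconst : ∀ᶠ x in atTop, u x = u r := by
    filter_upwards [eventually_ge_atTop r] with x hx
    have hint : ∫ t in r..x, u' t = 0 := by
      refine intervalIntegral.integral_zero_ae ?_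
      filter_upwards [(ae_restrict_iff' measurableSet_Ioi).1 h0] with t ht hmem
      rw [Set.uIoc_of_le hx] at hmem
      exact ht (hr.trans hmem.1)
    have := h.ftc r x hr hx
    linarith
  exact tendsto_nhds_unique ((tendsto_congr' hconst).2 tendsto_const_nhds) h.lim_zero

lemma MemX.TMfunc_eq_zero {p θ μ : ℝ} (hp : 1 < p) (hθ : 0 ≤ θ) {u u' : ℝ → ℝ} {α : ℝ}
    (h : MemX p α θ u u') (h0 : (wInt θ fun r => |u r| ^ p) = 0) : TMfunc p θ μ u = 0 :=
  _root_.TMfunc_eq_zero hp (ae_eq_zero_of_wInt_eq_zero hθ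
    (h.continuousOn.aemeasurable measurableSet_Ioi) h0)

lemma MemX.TMfunc_eq_zero_of_deriv {p θ μ α : ℝ} (hp : 1 < p) (hα : 0 ≤ α) {u u' : ℝ → ℝ}
    (h : MemX p α θ u u') (h0 : (wInt α fun r => |u' r| ^ p) = 0) : TMfunc p θ μ u = 0 := by
  refine _root_.TMfunc_eq_zero hp ((ae_restrict_mem measurableSet_Ioi).mono fun r hr => ?_)
  exact h.eq_zero_of_deriv
    (ae_eq_zero_of_wInt_eq_zero hα h.aemeasurable_deriv h0) hr

lemma ofReal_mul_le_TMC {p θ σ μ : ℝ} (hp : 1 < p) (hθ : 0 ≤ θ) (hμ : 0 < μ) (hμσ : μ < σ)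
    {u u' : ℝ → ℝ} (h : MemX p (p - 1) θ u u') (hu' : wNorm (p - 1) p u' ≤ 1) :
    ENNReal.ofReal ((1 - (μ / σ) ^ (p - 1)) / (μ / σ) ^ (p - 1)) *
      (wNorm θ p u ^ (-p) * TMfunc p θ μ u) ≤ TMC p (p - 1) θ σ := by
  have hp0 : 0 < p := by linarith
  have hp1 : 0 < p - 1 := by linarith
  have hσ : 0 < σ := hμ.trans hμσ
  have hm : 0 < μ / σ := div_pos hμ hσ
  rw [ENNReal.rpow_neg, wNorm_rpow hp0]
  have hA := (wNorm_lt_top_iff hp0 _ _).1 h.fin_u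
  have hB := (wNorm_le_one_iff hp0 _ _).1 hu'
  rcases eq_or_ne (wInt θ fun r => |u r| ^ p) 0 with hA0 | hA0
  · simp [h.TMfunc_eq_zero hp hθ hA0]
  set a := (wInt θ fun r => |u r| ^ p).toReal with ha
  have ha0 : 0 < a := ENNReal.toReal_pos hA0 hA.ne
  have hAa : (wInt θ fun r => |u r| ^ p) = ENNReal.ofReal a := (ENNReal.ofReal_toReal hA.ne).symm
  set t := (μ / σ) ^ (p - 1) with ht
  have ht0 : 0 < t := Real.rpow_pos_of_pos hm _
  have ht1 : t < 1 := Real.rpow_lt_one hm.le ((div_lt_one hσ).2 hμσ) hp1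
  set c := (μ / σ) ^ ((p - 1) / p) with hc
  have hc0 : 0 < c := Real.rpow_pos_of_pos hm _
  have hcp : c ^ p = t := by
    rw [hc, ← Real.rpow_mul hm.le, div_mul_cancel₀ _ hp0.ne']
  have hcq : σ * c ^ (p / (p - 1)) = μ := by
    rw [hc, ← Real.rpow_mul hm.le, div_mul_div_cancel₀ hp0.ne', div_self hp1.ne', Real.rpow_one,
      mul_div_cancel₀ _ hσ.ne']
  set s := (1 - t) / t / a with hs
  have hs0 : 0 < s := div_pos (div_pos (by linarith) ht0) ha0
  set l := s ^ (-(θ + 1)⁻¹) with hl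
  have hl0 : 0 < l := Real.rpow_pos_of_pos hs0 _
  have hls : l ^ (-(θ + 1)) = s := by
    rw [hl, ← Real.rpow_mul hs0.le, neg_mul_neg, inv_mul_cancel₀ (by linarith), Real.rpow_one]
  have hv := h.dilation hp0 hc0 hl0
  have hT := TMfunc_dilation hc0 hl0 p θ σ u
  rw [hls, hcq] at hT
  have hle : Xnorm p (p - 1) θ (fun r => c * u (l * r)) (fun r => c * l * u' (l * r)) ≤ 1 := by
    rw [Xnorm_le_one_iff hp0, wInt_dilation hc0 hl0, wInt_deriv_dilation hc0 hl0, hls, hcp, hAa,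
      ← ENNReal.ofReal_mul (by positivity)]
    calc _ ≤ ENNReal.ofReal (t * s * a) + ENNReal.ofReal t * 1 := by gcongr
      _ = 1 := by
        rw [mul_one, ← ENNReal.ofReal_add (by positivity) ht0.le, ← ENNReal.ofReal_one]
        congr 1
        rw [hs]
        field_simp
        ring
  have e : ENNReal.ofReal ((1 - t) / t) * ((ENNReal.ofReal a)⁻¹ * TMfunc p θ μ u) =
      TMfunc p θ σ (fun r => c * u (l * r)) := by
    rw [hT, ← mul_assoc, ← div_eq_mul_inv, ← ENNReal.ofReal_div_of_pos ha0]
  rw [hAa, e]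
  exact le_iSup_of_le _ (le_iSup_of_le _ (le_iSup_of_le hv (le_iSup_of_le hle le_rfl)))

lemma TMfunc_le_iSup {p θ σ : ℝ} (hp : 1 < p) (hθ : 0 ≤ θ) (hσ : 0 < σ)
    {u u' : ℝ → ℝ} (h : MemX p (p - 1) θ u u') (hu : Xnorm p (p - 1) θ u u' ≤ 1) :
    TMfunc p θ σ u ≤ ⨆ (μ : ℝ) (_ : μ ∈ Set.Ioo 0 σ),
      ENNReal.ofReal ((1 - (μ / σ) ^ (p - 1)) / (μ / σ) ^ (p - 1)) * TMSC p (p - 1) θ μ := by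
  have hp0 : 0 < p := by linarith
  have hp1 : 0 < p - 1 := by linarith
  rw [Xnorm_le_one_iff hp0] at hu
  have hA := (wNorm_lt_top_iff hp0 _ _).1 h.fin_u
  have hB := (wNorm_lt_top_iff hp0 _ _).1 h.fin_u'
  rcases eq_or_ne (wInt θ fun r => |u r| ^ p) 0 with hA0 | hA0
  · simp [h.TMfunc_eq_zero hp hθ hA0]
  rcases eq_or_ne (wInt (p - 1) fun r => |u' r| ^ p) 0 with hB0 | hB0
  · simp [h.TMfunc_eq_zero_of_deriv hp hp1.le hB0]
  have hne : u ≠ 0 := by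
    rintro rfl
    refine hA0 ?_
    simp [wInt, Real.zero_rpow hp0.ne']
  set a := (wInt θ fun r => |u r| ^ p).toReal with ha
  have ha0 : 0 < a := ENNReal.toReal_pos hA0 hA.ne
  have hAa : (wInt θ fun r => |u r| ^ p) = ENNReal.ofReal a := (ENNReal.ofReal_toReal hA.ne).symm
  set b := (wInt (p - 1) fun r => |u' r| ^ p).toReal with hb
  have hb0 : 0 < b := ENNReal.toReal_pos hB0 hB.ne
  have hBb : (wInt (p - 1) fun r => |u' r| ^ p) = ENNReal.ofReal b :=
    (ENNReal.ofReal_toReal hB.ne).symm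
  have hab : a + b ≤ 1 := by
    rwa [hAa, hBb, ← ENNReal.ofReal_add ha0.le hb0.le, ENNReal.ofReal_le_one] at hu
  set m := b ^ (p - 1)⁻¹ with hm
  have hm0 : 0 < m := Real.rpow_pos_of_pos hb0 _
  have hm1 : m < 1 := Real.rpow_lt_one hb0.le (by linarith) (inv_pos.2 hp1)
  have hmb : m ^ (p - 1) = b := Real.rpow_inv_rpow hb0.le hp1.ne'
  set c := b ^ (-p⁻¹) with hc
  have hc0 : 0 < c := Real.rpow_pos_of_pos hb0 _
  have hcp : c ^ p = b⁻¹ := by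
    rw [hc, ← Real.rpow_mul hb0.le, neg_mul, inv_mul_cancel₀ hp0.ne', Real.rpow_neg_one]
  have hcq : σ * m * c ^ (p / (p - 1)) = σ := by
    rw [hc, hm, ← Real.rpow_mul hb0.le, mul_assoc, ← Real.rpow_add hb0]
    have : (p - 1)⁻¹ + -p⁻¹ * (p / (p - 1)) = 0 := by field_simp; ring
    rw [this, Real.rpow_zero, mul_one]
  have hv := h.dilation hp0 hc0 one_pos
  have hT := TMfunc_dilation hc0 one_pos p θ (σ * m) u
  rw [hcq, Real.one_rpow, ENNReal.ofReal_one, one_mul] at hT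
  have hv0 : (fun r => c * u (1 * r)) ≠ 0 := by
    intro h0
    refine hne (funext fun r => ?_)
    have := congrFun h0 r
    simpa [hc0.ne'] using this
  have hv1 : wNorm (p - 1) p (fun r => c * 1 * u' (1 * r)) ≤ 1 := by
    rw [wNorm_le_one_iff hp0, wInt_deriv_dilation hc0 one_pos, hcp, hBb,
      ← ENNReal.ofReal_mul (by positivity), inv_mul_cancel₀ hb0.ne', ENNReal.ofReal_one]
  have hS : wNorm θ p (fun r => c * u (1 * r)) ^ (-p) * TMfunc p θ (σ * m) (fun r => c * u (1 * r))
      ≤ TMSC p (p - 1) θ (σ * m) :=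
    le_iSup_of_le _ (le_iSup_of_le _ (le_iSup_of_le hv (le_iSup_of_le hv0
      (le_iSup_of_le hv1 le_rfl))))
  rw [ENNReal.rpow_neg, wNorm_rpow hp0, wInt_dilation hc0 one_pos, hcp, Real.one_rpow, mul_one,
    hAa, ← ENNReal.ofReal_mul (by positivity), hT] at hS
  refine le_iSup₂_of_le (σ * m) ⟨by positivity, mul_lt_of_lt_one_right hσ hm1⟩ ?_
  rw [mul_div_cancel_left₀ _ hσ.ne', hmb]
  refine le_trans ?_ (mul_le_mul_right hS _)
  rw [← mul_assoc, ← div_eq_mul_inv, ← ENNReal.ofReal_div_of_pos (by positivity)]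
  refine le_mul_of_one_le_left' ?_
  rw [ENNReal.one_le_ofReal]
  have : (1 - b) / b / (b⁻¹ * a) = (1 - b) / a := by field_simp
  rw [this, one_le_div ha0]
  linarith

theorem stmt_5 (p α θ σ : ℝ) (hp : 2 ≤ p) (hα : α = p - 1) (hθ : 0 ≤ θ)
    (hσ : 0 < σ) (hσ' : σ ≤ muC α θ) :
    TMC p α θ σ = ⨆ (μ : ℝ) (_ : μ ∈ Set.Ioo 0 σ),
      ENNReal.ofReal ((1 - (μ / σ) ^ (p - 1)) / (μ / σ) ^ (p - 1)) * TMSC p α θ μ := by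
  subst hα
  have hp1 : 1 < p := by linarith
  refine le_antisymm ?_ ?_
  · exact iSup_le fun u => iSup_le fun u' => iSup_le fun h => iSup_le fun hu =>
      TMfunc_le_iSup hp1 hθ hσ h hu
  · refine iSup₂_le fun μ hμ => ?_
    simp only [TMSC, ENNReal.mul_iSup]
    exact iSup_le fun u => iSup_le fun u' => iSup_le fun h => iSup_le fun _ => iSup_le fun hu' =>
      ofReal_mul_le_TMC hp1 hθ hμ.1 hμ.2 h hu'
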